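/- Let (d_i)_{i≥1} be an alternate Lyndon word over a finite alphabet A = {0,1,…,d_1} and let M be the associated Lyndon system. Then M has topological entropy zero if and only if (d_i)_{i≥1} is the constant sequence \overline{0}, or (d_i)_{i≥1} = φ^∞(1), or (d_i)_{i≥1} = \overline{φ^n(1)} (the periodic repetition of the finite word φ^n(1)) for some n ∈ ℕ. -/

import Mathlib

open Filter Topology

/-- Alternate (Ito–Sadahiro) strict order on infinite sequences (0-indexed: entry `i`
is the `(i+1)`-th letter `x_{i+1}` of the paper). `altLt x y` iff at the first index
where they differ the comparison alternates with the parity of the index: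
`(-1)^k (x_k - y_k) < 0` in 1-based indexing. -/
def altLt (x y : ℕ → ℕ) : Prop :=
  ∃ k : ℕ, (∀ i < k, x i = y i) ∧ (if Even k then y k < x k else x k < y k)

def altLe (x y : ℕ → ℕ) : Prop := x = y ∨ altLt x y

def shiftSeq (x : ℕ → ℕ) (k : ℕ) : ℕ → ℕ := fun i => x (k + i)

/-- An alternate Lyndon word: smaller (in the alternate order) than all of its shifts. -/
def IsAltLyndon (d : ℕ → ℕ) : Prop := ∀ k : ℕ, altLe d (shiftSeq d k)

/-- The Lyndon system associated to `d`: sequences over the alphabet `{0, …, d_1}`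
all of whose shifts dominate `d` in the alternate order. -/
def LyndonSystem (d : ℕ → ℕ) : Set (ℕ → ℕ) :=
  {x | (∀ i, x i ≤ d 0) ∧ ∀ k : ℕ, altLe d (shiftSeq x k)}

def IsFactorOf (w : List ℕ) (x : ℕ → ℕ) : Prop :=
  ∃ k : ℕ, w = (List.range w.length).map (fun i => x (k + i))

/-- The language of the Lyndon system: finite factors of its elements. -/
def LyndonLang (d : ℕ → ℕ) : Set (List ℕ) :=
  {w | ∃ x ∈ LyndonSystem d, IsFactorOf w x}

/-- `Hword d n` is the number of words of length `n` in the language `L_M`. -/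
noncomputable def Hword (d : ℕ → ℕ) (n : ℕ) : ℕ :=
  Set.ncard {w : List ℕ | w ∈ LyndonLang d ∧ w.length = n}

/-- The topological entropy of the Lyndon system of `d` equals `h`,
i.e. `lim_{n→∞} (log H_n)/n = h`. -/
def EntropyIs (d : ℕ → ℕ) (h : ℝ) : Prop :=
  Filter.Tendsto (fun n : ℕ => Real.log (Hword d n) / n) Filter.atTop (nhds h)

/-- The substitution `φ` on letters: `φ(0) = 1`, `φ(1) = 100`. -/
def phiL (a : ℕ) : List ℕ := if a = 0 then [1] else [1, 0, 0]
/-- `φ` extended to words. -/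
def phiW (w : List ℕ) : List ℕ := w.flatMap phiL
/-- `uW n = φ^n(1)`. -/
def uW (n : ℕ) : List ℕ := phiW^[n] [1]
/-- The infinite fixed point `φ^∞(1)` (each `uW n` is a prefix of `uW (n+1)`,
and `|uW (i+1)| > i`, so the definition below gives the limit word). -/
def phiInf : ℕ → ℕ := fun i => (uW (i + 1)).getD i 0

/-- The periodic infinite word `\overline{w}` associated to a finite word `w`. -/
def periodicSeq (w : List ℕ) : ℕ → ℕ := fun i => w.getD (i % w.length) 0
/-- The infinite word `p \overline{w}`: the finite word `p` followed by the
periodic repetition of `w`. -/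
def prefixPeriodic (p w : List ℕ) : ℕ → ℕ :=
  fun i => if i < p.length then p.getD i 0 else w.getD ((i - p.length) % w.length) 0

/-- Binary sequences. -/
def Bin (x : ℕ → ℕ) : Prop := ∀ i, x i ≤ 1

/-- Agreement of two sequences on the first `N` entries. -/
def Agr (N : ℕ) (x y : ℕ → ℕ) : Prop := ∀ i < N, x i = y i

/-- The substitution on infinite sequences. -/
def PhiAux : ℕ → (ℕ → ℕ) → ℕ
  | 0, _ => 1
  | 1, x => if x 0 = 0 then PhiAux 0 (shiftSeq x 1) else 0
  | 2, x => if x 0 = 0 then PhiAux 1 (shiftSeq x 1) else 0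
  | n + 3, x => if x 0 = 0 then PhiAux (n + 2) (shiftSeq x 1) else PhiAux n (shiftSeq x 1)

def Phi (x : ℕ → ℕ) : ℕ → ℕ := fun n => PhiAux n x

lemma Phi_zero (x : ℕ → ℕ) : Phi x 0 = 1 := by simp [Phi, PhiAux]

lemma Phi_z (x : ℕ → ℕ) (h : x 0 = 0) (n : ℕ) : Phi x (n + 1) = Phi (shiftSeq x 1) n := by
  match n with
  | 0 => simp [Phi, PhiAux, h]
  | 1 => simp [Phi, PhiAux, h]
  | n + 2 => simp [Phi, PhiAux, h]

lemma Phi_o1 (x : ℕ → ℕ) (h : x 0 ≠ 0) : Phi x 1 = 0 := by simp [Phi, PhiAux, h]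
lemma Phi_o2 (x : ℕ → ℕ) (h : x 0 ≠ 0) : Phi x 2 = 0 := by simp [Phi, PhiAux, h]
lemma Phi_o (x : ℕ → ℕ) (h : x 0 ≠ 0) (n : ℕ) : Phi x (n + 3) = Phi (shiftSeq x 1) n := by
  simp [Phi, PhiAux, h]

lemma Phi_bin (x : ℕ → ℕ) : Bin (Phi x) := by
  intro n
  induction n using Nat.strong_induction_on generalizing x with
  | _ n ih =>
    by_cases h : x 0 = 0
    · match n with
      | 0 => simp [Phi_zero]
      | n + 1 => rw [Phi_z x h]; exact ih n (by omega) _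
    · match n with
      | 0 => simp [Phi_zero]
      | 1 => simp [Phi_o1 x h]
      | 2 => simp [Phi_o2 x h]
      | n + 3 => rw [Phi_o x h]; exact ih n (by omega) _

lemma shift_shift (x : ℕ → ℕ) (a b : ℕ) : shiftSeq (shiftSeq x a) b = shiftSeq x (a + b) := by
  funext i; simp [shiftSeq, add_assoc]

lemma shift_zero (x : ℕ → ℕ) : shiftSeq x 0 = x := by
  funext i; simp [shiftSeq]

lemma Bin.shift {x : ℕ → ℕ} (h : Bin x) (k : ℕ) : Bin (shiftSeq x k) := fun i => h _

lemma shift_Phi_z (x : ℕ → ℕ) (h : x 0 = 0) : shiftSeq (Phi x) 1 = Phi (shiftSeq x 1) := by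
  funext n; rw [← Phi_z x h, shiftSeq, add_comm]

lemma shift_Phi_o (x : ℕ → ℕ) (h : x 0 ≠ 0) : shiftSeq (Phi x) 3 = Phi (shiftSeq x 1) := by
  funext n; rw [← Phi_o x h, shiftSeq, add_comm]

/-! ### order -/

lemma altLt_of_shift (x y : ℕ → ℕ) (m : ℕ) (hm : ¬ Even m) (ha : Agr m x y)
    (h : altLt (shiftSeq y m) (shiftSeq x m)) : altLt x y := by
  obtain ⟨k, h1, h2⟩ := h
  refine ⟨m + k, ?_, ?_⟩
  · intro i hi
    by_cases him : i < m
    · exact ha i him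
    · have := h1 (i - m) (by omega)
      simp only [shiftSeq] at this
      rw [show m + (i - m) = i by omega] at this
      exact this.symm
  · by_cases hk : Even k
    · have : ¬ Even (m + k) := by rw [Nat.even_add]; tauto
      simpa [this, hk, shiftSeq] using h2
    · have : Even (m + k) := by rw [Nat.even_add]; tauto
      simpa [this, hk, shiftSeq] using h2

lemma Phi_lt_aux (k : ℕ) (x y : ℕ → ℕ) (hx : Bin x) (hy : Bin y) (h1 : ∀ i < k, x i = y i)
    (h2 : if Even k then y k < x k else x k < y k) : altLt (Phi x) (Phi y) := by
  induction k generalizing x y with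
  | zero =>
    simp only [Even.zero, if_true] at h2
    have := hx 0
    have hx0 : x 0 ≠ 0 := by omega
    have hy0 : y 0 = 0 := by omega
    refine ⟨1, ?_, ?_⟩
    · intro i hi
      obtain rfl : i = 0 := by omega
      simp [Phi_zero]
    · rw [Phi_o1 x hx0, Phi_z y hy0 0, Phi_zero]; simp
  | succ k ih =>
    have h0 := h1 0 (by omega)
    have key : altLt (Phi (shiftSeq y 1)) (Phi (shiftSeq x 1)) := by
      apply ih _ _ (hy.shift 1) (hx.shift 1)
      · intro i hi
        have := h1 (1 + i) (by omega)
        simp [shiftSeq, this]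
      · simp only [Nat.even_add_one] at h2
        by_cases hk : Even k
        · simpa [hk, shiftSeq, add_comm] using h2
        · simpa [hk, shiftSeq, add_comm] using h2
    by_cases hx0 : x 0 = 0
    · rw [← shift_Phi_z x hx0, ← shift_Phi_z y (h0 ▸ hx0)] at key
      refine altLt_of_shift _ _ 1 (by decide) ?_ key
      intro i hi
      obtain rfl : i = 0 := by omega
      simp [Phi_zero]
    · have hy0 : y 0 ≠ 0 := h0 ▸ hx0
      rw [← shift_Phi_o x hx0, ← shift_Phi_o y hy0] at key
      refine altLt_of_shift _ _ 3 (by decide) ?_ key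
      intro i hi
      interval_cases i
      · simp [Phi_zero]
      · simp [Phi_o1 _ hx0, Phi_o1 _ hy0]
      · simp [Phi_o2 _ hx0, Phi_o2 _ hy0]

lemma Phi_lt {x y : ℕ → ℕ} (hx : Bin x) (hy : Bin y) (h : altLt x y) :
    altLt (Phi x) (Phi y) := by
  obtain ⟨k, h1, h2⟩ := h
  exact Phi_lt_aux k x y hx hy h1 h2

lemma Phi_le {x y : ℕ → ℕ} (hx : Bin x) (hy : Bin y) (h : altLe x y) :
    altLe (Phi x) (Phi y) := by
  rcases h with rfl | h
  · exact Or.inl rfl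
  · exact Or.inr (Phi_lt hx hy h)

lemma altLe_total (x y : ℕ → ℕ) : altLe x y ∨ altLt y x := by
  by_cases h : x = y
  · exact Or.inl (Or.inl h)
  · have h' : ∃ k, x k ≠ y k := by
      by_contra hc
      push Not at hc
      exact h (funext hc)
    classical
    have hs := Nat.find_spec h'
    have hm : ∀ i < Nat.find h', x i = y i := fun i hi => by
      by_contra hc; exact Nat.find_min h' hi hc
    generalize Nat.find h' = k at hs hm
    rcases lt_or_gt_of_ne hs with hl | hl <;> by_cases hk : Even k
    · right; exact ⟨k, fun i hi => (hm i hi).symm, by simpa [hk] using hl⟩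
    · left; right; exact ⟨k, hm, by simpa [hk] using hl⟩
    · left; right; exact ⟨k, hm, by simpa [hk] using hl⟩
    · right; exact ⟨k, fun i hi => (hm i hi).symm, by simpa [hk] using hl⟩

lemma not_le_of_altLt {x y : ℕ → ℕ} (h : altLt y x) : ¬ altLe x y := by
  obtain ⟨k, h1, h2⟩ := h
  rintro (rfl | ⟨l, h3, h4⟩)
  · split_ifs at h2 <;> omega
  · rcases lt_trichotomy k l with hkl | rfl | hkl
    · have := h3 k hkl
      split_ifs at h2 <;> omega
    · split_ifs at h2 h4 <;> omega
    · have := h1 l hkl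
      split_ifs at h4 <;> omega

lemma le_of_Phi_le {x y : ℕ → ℕ} (hx : Bin x) (hy : Bin y) (h : altLe (Phi x) (Phi y)) :
    altLe x y := by
  rcases altLe_total x y with h1 | h1
  · exact h1
  · exact absurd h (not_le_of_altLt (Phi_lt hy hx h1))

lemma altLe_head {x y : ℕ → ℕ} (h : altLe x y) : y 0 ≤ x 0 := by
  by_contra hc
  exact not_le_of_altLt (x := x) (y := y) ⟨0, by simp, by simp; omega⟩ h

lemma altLe_of_head {x y : ℕ → ℕ} (h : y 0 < x 0) : altLe x y :=
  Or.inr ⟨0, by simp, by simpa using h⟩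

/-! ### shifts of images -/

lemma shift_Phi_cases (k : ℕ) (y : ℕ → ℕ) :
    (∃ m, shiftSeq (Phi y) k = Phi (shiftSeq y m)) ∨ Phi y k = 0 := by
  induction k using Nat.strong_induction_on generalizing y with
  | _ k ih =>
    by_cases h : y 0 = 0
    · match k with
      | 0 => exact Or.inl ⟨0, by simp [shift_zero]⟩
      | k + 1 =>
        rcases ih k (by omega) (shiftSeq y 1) with ⟨m, hm⟩ | hm
        · left
          refine ⟨1 + m, ?_⟩
          rw [← shift_shift y 1 m, ← hm, ← shift_Phi_z y h, shift_shift, add_comm]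
        · right; rw [Phi_z y h, hm]
    · match k with
      | 0 => exact Or.inl ⟨0, by simp [shift_zero]⟩
      | 1 => exact Or.inr (Phi_o1 y h)
      | 2 => exact Or.inr (Phi_o2 y h)
      | k + 3 =>
        rcases ih k (by omega) (shiftSeq y 1) with ⟨m, hm⟩ | hm
        · left
          refine ⟨1 + m, ?_⟩
          rw [← shift_shift y 1 m, ← hm, ← shift_Phi_o y h, shift_shift, add_comm]
        · right; rw [Phi_o y h, hm]

lemma Phi_shift_exists (m : ℕ) (y : ℕ → ℕ) :
    ∃ k, Phi (shiftSeq y m) = shiftSeq (Phi y) k := by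
  induction m generalizing y with
  | zero => exact ⟨0, by simp [shift_zero]⟩
  | succ m ih =>
    obtain ⟨k, hk⟩ := ih (shiftSeq y 1)
    rw [shift_shift, add_comm] at hk
    by_cases h : y 0 = 0
    · exact ⟨1 + k, by rw [hk, ← shift_Phi_z y h, shift_shift]⟩
    · exact ⟨3 + k, by rw [hk, ← shift_Phi_o y h, shift_shift]⟩

/-! ### systems -/

lemma mem_bin {d x : ℕ → ℕ} (h0 : d 0 = 1) (hx : x ∈ LyndonSystem d) : Bin x :=
  fun i => h0 ▸ hx.1 i

lemma shift_mem {d x : ℕ → ℕ} (hx : x ∈ LyndonSystem d) (k : ℕ) :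
    shiftSeq x k ∈ LyndonSystem d :=
  ⟨fun i => hx.1 _, fun j => by rw [shift_shift]; exact hx.2 _⟩

lemma Phi_mem {e y : ℕ → ℕ} (h0 : e 0 = 1) (he : Bin e) (hy : y ∈ LyndonSystem e) :
    Phi y ∈ LyndonSystem (Phi e) := by
  have hyb := mem_bin h0 hy
  refine ⟨fun i => by rw [Phi_zero]; exact Phi_bin y i, fun k => ?_⟩
  rcases shift_Phi_cases k y with ⟨m, hm⟩ | h
  · rw [hm]; exact Phi_le he (hyb.shift m) (hy.2 m)
  · exact altLe_of_head (by simp [shiftSeq, h, Phi_zero])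

lemma mem_of_Phi_mem {e y : ℕ → ℕ} (h0 : e 0 = 1) (he : Bin e) (hyb : Bin y)
    (hy : Phi y ∈ LyndonSystem (Phi e)) : y ∈ LyndonSystem e := by
  refine ⟨fun i => by rw [h0]; exact hyb i, fun m => ?_⟩
  obtain ⟨k, hk⟩ := Phi_shift_exists m y
  exact le_of_Phi_le he (hyb.shift m) (hk ▸ hy.2 k)

/-- Sequences whose blocks are `1` and `100`, from every occurrence of `1`. -/
def Good (x : ℕ → ℕ) : Prop :=
  ∀ k, x k = 1 → x (k + 1) = 1 ∨ (x (k + 1) = 0 ∧ x (k + 2) = 0 ∧ x (k + 3) = 1)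

lemma Good.shift {x : ℕ → ℕ} (h : Good x) (k : ℕ) : Good (shiftSeq x k) := by
  intro j hj
  exact h (k + j) hj

/-- Inverse of the substitution. -/
def invPhi : ℕ → (ℕ → ℕ) → ℕ
  | 0, x => if x 1 = 1 then 0 else 1
  | n + 1, x => invPhi n (if x 1 = 1 then shiftSeq x 1 else shiftSeq x 3)

lemma invPhi_bin (n : ℕ) (x : ℕ → ℕ) : invPhi n x ≤ 1 := by
  induction n generalizing x with
  | zero => simp only [invPhi]; split_ifs <;> simp
  | succ n ih => exact ih _

lemma Phi_inv (n : ℕ) (x : ℕ → ℕ) (hx : Good x) (h0 : x 0 = 1) :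
    Phi (fun i => invPhi i x) n = x n := by
  induction n using Nat.strong_induction_on generalizing x with
  | _ n ih =>
    rcases hx 0 h0 with h | ⟨h1, h2, h3⟩
    · match n with
      | 0 => simp [Phi_zero, h0]
      | n + 1 =>
        rw [Phi_z _ (by simpa [invPhi] using h)]
        have : shiftSeq (fun i => invPhi i x) 1 = fun i => invPhi i (shiftSeq x 1) := by
          funext i; simp only [shiftSeq]; rw [add_comm]; simp [invPhi, (by simpa using h : x 1 = 1)]
        rw [this, ih n (by omega) _ (hx.shift 1) (by simpa [shiftSeq] using h), shiftSeq, add_comm]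
    · simp only [zero_add] at h1 h2 h3
      have hne : (fun i => invPhi i x) 0 ≠ 0 := by simp [invPhi, h1]
      match n with
      | 0 => simp [Phi_zero, h0]
      | 1 => rw [Phi_o1 _ hne, h1]
      | 2 => rw [Phi_o2 _ hne, h2]
      | n + 3 =>
        rw [Phi_o _ hne]
        have : shiftSeq (fun i => invPhi i x) 1 = fun i => invPhi i (shiftSeq x 3) := by
          funext i; simp only [shiftSeq]; rw [add_comm]; simp [invPhi, h1]
        rw [this, ih n (by omega) _ (hx.shift 3) (by simpa [shiftSeq] using h3), shiftSeq, add_comm]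

lemma exists_Phi {x : ℕ → ℕ} (hx : Good x) (h0 : x 0 = 1) : ∃ y, Bin y ∧ x = Phi y :=
  ⟨fun i => invPhi i x, fun i => invPhi_bin i x, (funext fun n => (Phi_inv n x hx h0).symm)⟩

/-- Members of systems whose base starts with `1001` are good. -/
lemma good_of_mem {d x : ℕ → ℕ} (h0 : d 0 = 1) (h1 : d 1 = 0) (h2 : d 2 = 0) (h3 : d 3 = 1)
    (hx : x ∈ LyndonSystem d) : Good x := by
  intro k hk
  have hb := mem_bin h0 hx
  by_cases hk1 : x (k + 1) = 1
  · exact Or.inl hk1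
  have hk1' : x (k + 1) = 0 := by have := hb (k + 1); omega
  right
  refine ⟨hk1', ?_⟩
  have hle := hx.2 k
  have hk2 : x (k + 2) = 0 := by
    by_contra hc
    refine not_le_of_altLt ⟨2, ?_, ?_⟩ hle
    · intro i hi
      interval_cases i <;> simp [shiftSeq, *]
    · simp [shiftSeq, h2]; omega
  refine ⟨hk2, ?_⟩
  by_contra hc
  have hk3 : x (k + 3) = 0 := by have := hb (k + 3); omega
  refine not_le_of_altLt ⟨3, ?_, ?_⟩ hle
  · intro i hi
    interval_cases i <;> simp [shiftSeq, *]
  · rw [if_neg (by decide)]; simp [shiftSeq, *]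

lemma Phi_base {e : ℕ → ℕ} (h0 : e 0 = 1) :
    Phi e 0 = 1 ∧ Phi e 1 = 0 ∧ Phi e 2 = 0 ∧ Phi e 3 = 1 := by
  have h : e 0 ≠ 0 := by omega
  exact ⟨Phi_zero _, Phi_o1 _ h, Phi_o2 _ h, by rw [Phi_o _ h 0, Phi_zero]⟩

/-- Prepend `i` zeros. -/
def Gz (i : ℕ) (x : ℕ → ℕ) : ℕ → ℕ := fun n => if n < i then 0 else x (n - i)

lemma zero_mem {e : ℕ → ℕ} (h0 : e 0 = 1) : (fun _ => 0) ∈ LyndonSystem e :=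
  ⟨fun i => by simp, fun k => altLe_of_head (by simp [shiftSeq, h0])⟩

/-- Every binary sequence is, up to `N`, zeros followed by a sequence starting with `1`. -/
lemma first_one (x : ℕ → ℕ) (hb : Bin x) (N : ℕ) :
    (∀ i < N, x i = 0) ∨ ∃ i ≤ N, x i = 1 ∧ x = Gz i (shiftSeq x i) := by
  classical
  by_cases h : ∃ i, i < N ∧ x i = 1
  · right
    refine ⟨Nat.find h, (Nat.find_spec h).1.le, (Nat.find_spec h).2, ?_⟩
    funext n
    simp only [Gz, shiftSeq]
    split_ifs with hn
    · have := Nat.find_min h hn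
      have h1 := hb n
      have h2 := (Nat.find_spec h).1
      by_contra hc
      exact this ⟨by omega, by omega⟩
    · rw [Nat.add_sub_cancel' (by omega)]
  · left
    intro i hi
    have := hb i
    by_contra hc
    exact h ⟨i, hi, by omega⟩

lemma decomp {e x : ℕ → ℕ} (h0 : e 0 = 1) (he : Bin e) (hx : x ∈ LyndonSystem (Phi e)) (N : ℕ) :
    ∃ i ≤ N, ∃ y ∈ LyndonSystem e, Agr N x (Gz i (Phi y)) := by
  obtain ⟨b0, b1, b2, b3⟩ := Phi_base h0
  rcases first_one x (mem_bin b0 hx) N with h | ⟨i, hi, h1, hG⟩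
  · exact ⟨N, le_rfl, _, zero_mem h0, fun i hi => by rw [h i hi]; simp [Gz, hi]⟩
  · have hs := shift_mem hx i
    obtain ⟨y, hyb, hy⟩ := exists_Phi (good_of_mem b0 b1 b2 b3 hs) (by simpa [shiftSeq] using h1)
    refine ⟨i, hi, y, mem_of_Phi_mem h0 he hyb (hy ▸ hs), fun j _ => ?_⟩
    rw [← hy, ← hG]

/-! ### positive entropy criterion -/

def Pos (d : ℕ → ℕ) : Prop := ∃ n : ℕ, ∀ y, Bin y → Phi^[n] y ∈ LyndonSystem d

lemma pos_Phi {e : ℕ → ℕ} (h0 : e 0 = 1) (he : Bin e) (h : Pos e) : Pos (Phi e) := by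
  obtain ⟨n, hn⟩ := h
  refine ⟨n + 1, fun y hy => ?_⟩
  rw [Function.iterate_succ_apply']
  exact Phi_mem h0 he (hn y hy)

lemma pos_of_two_le {d : ℕ → ℕ} (h : 2 ≤ d 0) : Pos d := by
  refine ⟨0, fun y hy => ⟨fun i => (hy i).trans (by omega), fun k => altLe_of_head ?_⟩⟩
  have := hy k
  simp [shiftSeq]
  omega

lemma pos_of_start {d : ℕ → ℕ} (h0 : d 0 = 1) (h1 : d 1 = 0)
    (h : d 2 = 1 ∨ (d 2 = 0 ∧ d 3 = 0)) : Pos d := by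
  refine ⟨1, fun y hy => ⟨fun i => by rw [h0]; exact Phi_bin y i, fun k => ?_⟩⟩
  simp only [Function.iterate_one]
  rcases shift_Phi_cases k y with ⟨m, hm⟩ | hm
  · rw [hm]
    generalize shiftSeq y m = z
    right
    by_cases hz : z 0 = 0
    · refine ⟨1, ?_, ?_⟩
      · intro i hi
        obtain rfl : i = 0 := by omega
        rw [h0, Phi_zero]
      · rw [if_neg (by decide), h1, Phi_z z hz 0, Phi_zero]; simp
    · rcases h with h2 | ⟨h2, h3⟩
      · refine ⟨2, ?_, ?_⟩
        · intro i hi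
          interval_cases i
          · rw [h0, Phi_zero]
          · rw [h1, Phi_o1 z hz]
        · rw [if_pos (by decide), h2, Phi_o2 z hz]; simp
      · refine ⟨3, ?_, ?_⟩
        · intro i hi
          interval_cases i
          · rw [h0, Phi_zero]
          · rw [h1, Phi_o1 z hz]
          · rw [h2, Phi_o2 z hz]
        · rw [if_neg (by decide), h3, Phi_o z hz 0, Phi_zero]; simp
  · exact altLe_of_head (by simp [shiftSeq, hm, h0])

/-! ### Lyndon words -/

lemma lyndon_mem {d : ℕ → ℕ} (hd : IsAltLyndon d) : d ∈ LyndonSystem d :=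
  ⟨fun i => by simpa [shiftSeq] using altLe_head (hd i), hd⟩

lemma eq_one_of_start {d : ℕ → ℕ} (hd : IsAltLyndon d) (h0 : d 0 = 1) (h1 : d 1 = 1) :
    d = fun _ => 1 := by
  have hb := mem_bin h0 (lyndon_mem hd)
  funext n
  induction n with
  | zero => exact h0
  | succ n ih =>
    by_contra hc
    have := hb (n + 1)
    refine not_le_of_altLt ⟨1, ?_, ?_⟩ (hd n)
    · intro i hi
      obtain rfl : i = 0 := by omega
      simp [shiftSeq, h0, ih]
    · rw [if_neg (by decide), h1]; simp [shiftSeq]; omega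

/-- One renormalization step. -/
lemma renorm {d : ℕ → ℕ} (hd : IsAltLyndon d) (h0 : d 0 = 1) :
    d = (fun _ => 1) ∨ Pos d ∨ ∃ e, IsAltLyndon e ∧ e 0 = 1 ∧ d = Phi e := by
  have hm := lyndon_mem hd
  have hb := mem_bin h0 hm
  have b1 := hb 1
  have b2 := hb 2
  have b3 := hb 3
  by_cases h1 : d 1 = 1
  · exact Or.inl (eq_one_of_start hd h0 h1)
  have h1 : d 1 = 0 := by omega
  right
  by_cases h : d 2 = 1 ∨ (d 2 = 0 ∧ d 3 = 0)
  · exact Or.inl (pos_of_start h0 h1 h)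
  right
  have h2 : d 2 = 0 := by omega
  have h3 : d 3 = 1 := by omega
  obtain ⟨e, heb, rfl⟩ := exists_Phi (good_of_mem h0 h1 h2 h3 hm) h0
  have he0 : e 0 = 1 := by
    have := heb 0
    by_contra hc
    have hz : e 0 = 0 := by omega
    rw [Phi_z e hz 0, Phi_zero] at h1
    omega
  exact ⟨e, (mem_of_Phi_mem he0 heb heb hm).2, he0, rfl⟩

/-! ### words and sequences -/

def app : List ℕ → (ℕ → ℕ) → ℕ → ℕ
  | [], x, n => x n
  | a :: _, _, 0 => a
  | _ :: l, x, n + 1 => app l x n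

lemma app_nil (x : ℕ → ℕ) : app [] x = x := by funext n; simp [app]

lemma app_append (l m : List ℕ) (x : ℕ → ℕ) : app (l ++ m) x = app l (app m x) := by
  induction l with
  | nil => simp [app_nil]
  | cons a l ih =>
    funext n
    cases n with
    | zero => simp [app]
    | succ n => simp [app, ih]

lemma app_lt (l : List ℕ) (x : ℕ → ℕ) (n : ℕ) (h : n < l.length) : app l x n = l.getD n 0 := by
  induction l generalizing n with
  | nil => simp at h
  | cons a l ih =>
    cases n with
    | zero => simp [app]
    | succ n =>
      simp only [app]
      rw [ih n (by simpa using h)]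
      simp

lemma app_add (l : List ℕ) (x : ℕ → ℕ) (n : ℕ) : app l x (n + l.length) = x n := by
  induction l with
  | nil => simp [app]
  | cons a l ih => simpa [app, ← add_assoc] using ih

lemma shift_app_cons (a : ℕ) (l : List ℕ) (x : ℕ → ℕ) :
    shiftSeq (app (a :: l) x) 1 = app l x := by
  funext n; simp [shiftSeq, add_comm 1 n, app]

lemma Phi_app_cons (a : ℕ) (l : List ℕ) (x : ℕ → ℕ) :
    Phi (app (a :: l) x) = app (phiL a) (Phi (app l x)) := by
  funext n
  by_cases h : a = 0
  · have h' : app (a :: l) x 0 = 0 := by simp [app, h]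
    match n with
    | 0 => simp [Phi_zero, phiL, h, app]
    | n + 1 => rw [Phi_z _ h', shift_app_cons]; simp [phiL, h, app]
  · have h' : app (a :: l) x 0 ≠ 0 := by simp [app, h]
    match n with
    | 0 => simp [Phi_zero, phiL, h, app]
    | 1 => rw [Phi_o1 _ h']; simp [phiL, h, app]
    | 2 => rw [Phi_o2 _ h']; simp [phiL, h, app]
    | n + 3 => rw [Phi_o _ h', shift_app_cons]; simp [phiL, h, app]

lemma Phi_app (l : List ℕ) (x : ℕ → ℕ) : Phi (app l x) = app (phiW l) (Phi x) := by
  induction l with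
  | nil => simp [app_nil, phiW]
  | cons a l ih =>
    rw [Phi_app_cons, ih, ← app_append]
    simp [phiW]

lemma iter_Phi_app (n : ℕ) (l : List ℕ) (x : ℕ → ℕ) :
    Phi^[n] (app l x) = app (phiW^[n] l) (Phi^[n] x) := by
  induction n with
  | zero => rfl
  | succ n ih => simp only [Function.iterate_succ_apply', ih, Phi_app]

lemma app_one {e : ℕ → ℕ} (h0 : e 0 = 1) : e = app [1] (shiftSeq e 1) := by
  funext n
  cases n with
  | zero => simp [app, h0]
  | succ n => simp [app, shiftSeq, add_comm]

lemma iter_phiW_append (n : ℕ) (l m : List ℕ) :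
    phiW^[n] (l ++ m) = phiW^[n] l ++ phiW^[n] m := by
  induction n with
  | zero => rfl
  | succ n ih => simp only [Function.iterate_succ_apply', ih]; simp [phiW]

lemma length_phiW (l : List ℕ) : l.length ≤ (phiW l).length := by
  induction l with
  | nil => simp
  | cons a l ih =>
    have : phiW (a :: l) = phiL a ++ phiW l := by simp [phiW]
    have h2 : 1 ≤ (phiL a).length := by unfold phiL; split_ifs <;> simp
    rw [this, List.length_append, List.length_cons]
    omega

lemma length_iter_phiW (n : ℕ) (l : List ℕ) : l.length ≤ (phiW^[n] l).length := by
  induction n with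
  | zero => simp
  | succ n ih =>
    rw [Function.iterate_succ_apply']
    exact ih.trans (length_phiW _)

lemma uW_succ (n : ℕ) : uW (n + 1) = uW n ++ phiW^[n] [0, 0] := by
  unfold uW
  rw [← iter_phiW_append, Function.iterate_succ_apply]
  rfl

lemma uW_succ' (n : ℕ) : uW (n + 1) = phiW (uW n) := by
  unfold uW
  rw [Function.iterate_succ_apply']

lemma length_uW (n : ℕ) : n < (uW n).length := by
  induction n with
  | zero => simp [uW]
  | succ n ih =>
    rw [uW_succ, List.length_append]
    have := length_iter_phiW n [0, 0]
    simp at this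
    omega

lemma uW_getD (m n i : ℕ) (h : i < (uW n).length) (hnm : n ≤ m) :
    (uW m).getD i 0 = (uW n).getD i 0 := by
  induction m, hnm using Nat.le_induction with
  | base => rfl
  | succ m hm ih =>
    have hl : (uW n).length ≤ (uW m).length := by
      clear ih
      induction m, hm using Nat.le_induction with
      | base => rfl
      | succ m hm ih => rw [uW_succ, List.length_append]; omega
    rw [uW_succ, List.getD_append _ _ _ _ (by omega), ih]

lemma phiInf_eq (n i : ℕ) (h : i < (uW n).length) : phiInf i = (uW n).getD i 0 := by
  unfold phiInf
  rcases le_total (i + 1) n with h1 | h1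
  · rw [uW_getD n (i + 1) i (by have := length_uW (i + 1); omega) h1]
  · rw [uW_getD (i + 1) n i h h1]

lemma Phi_agr (N : ℕ) (x y : ℕ → ℕ) (h : Agr N x y) : Agr N (Phi x) (Phi y) := by
  intro n hn
  induction n using Nat.strong_induction_on generalizing x y N with
  | _ n ih =>
    have h0 := h 0 (by omega)
    have hs : Agr (N - 1) (shiftSeq x 1) (shiftSeq y 1) := fun i hi => h (1 + i) (by omega)
    by_cases hx : x 0 = 0
    · have hy : y 0 = 0 := h0 ▸ hx
      match n with
      | 0 => simp [Phi_zero]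
      | n + 1 => rw [Phi_z _ hx, Phi_z _ hy]; exact ih n (by omega) (N - 1) _ _ hs (by omega)
    · have hy : y 0 ≠ 0 := h0 ▸ hx
      match n with
      | 0 => simp [Phi_zero]
      | 1 => rw [Phi_o1 _ hx, Phi_o1 _ hy]
      | 2 => rw [Phi_o2 _ hx, Phi_o2 _ hy]
      | n + 3 => rw [Phi_o _ hx, Phi_o _ hy]; exact ih n (by omega) (N - 1) _ _ hs (by omega)

lemma Phi_phiInf : Phi phiInf = phiInf := by
  funext i
  have hl := length_uW i
  have h1 : Agr (uW i).length phiInf (app (uW i) phiInf) := by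
    intro j hj
    rw [phiInf_eq i j hj, app_lt _ _ _ hj]
  rw [Phi_agr _ _ _ h1 i hl, Phi_app, ← uW_succ']
  have := length_uW (i + 1)
  rw [app_lt _ _ _ (by omega), phiInf_eq (i + 1) i (by omega)]

lemma phiInf_zero : phiInf 0 = 1 := by
  rw [phiInf_eq 0 0 (by simp [uW])]; simp [uW]

lemma phiInf_bin : Bin phiInf := by rw [← Phi_phiInf]; exact Phi_bin _

lemma eq_periodic (z : ℕ → ℕ) (w : List ℕ) (hw : 0 < w.length) (h : z = app w z) :
    z = periodicSeq w := by
  funext i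
  induction i using Nat.strong_induction_on with
  | _ i ih =>
    by_cases hi : i < w.length
    · rw [h, app_lt _ _ _ hi, periodicSeq, Nat.mod_eq_of_lt hi]
    · have e1 : i = (i - w.length) + w.length := by omega
      have : z i = z (i - w.length) := by
        conv_lhs => rw [h, e1]
        rw [app_add]
      rw [this, ih _ (by omega), periodicSeq, periodicSeq]
      conv_rhs => rw [e1]
      rw [Nat.add_mod_right]

lemma periodic_uW (n : ℕ) : periodicSeq (uW n) = Phi^[n] (fun _ => 1) := by
  symm
  apply eq_periodic _ _ (by have := length_uW n; omega)
  have := iter_Phi_app n [1] (fun _ => 1)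
  rw [show app [1] (fun _ => 1) = (fun _ => 1) by funext n; cases n <;> simp [app]] at this
  exact this

lemma iter_one (n : ℕ) : Phi^[n] (fun _ => 1) 0 = 1 := by
  cases n with
  | zero => rfl
  | succ n => rw [Function.iterate_succ_apply', Phi_zero]

lemma iter_zero {e : ℕ → ℕ} (h0 : e 0 = 1) (n : ℕ) : Phi^[n] e 0 = 1 := by
  cases n with
  | zero => exact h0
  | succ n => rw [Function.iterate_succ_apply', Phi_zero]

lemma iter_bin {e : ℕ → ℕ} (h0 : Bin e) (n : ℕ) : Bin (Phi^[n] e) := by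
  cases n with
  | zero => exact h0
  | succ n => rw [Function.iterate_succ_apply']; exact Phi_bin _

lemma pos_iter {e : ℕ → ℕ} (h0 : e 0 = 1) (he : Bin e) (h : Pos e) (n : ℕ) : Pos (Phi^[n] e) := by
  induction n with
  | zero => exact h
  | succ n ih =>
    rw [Function.iterate_succ_apply']
    exact pos_Phi (iter_zero h0 n) (iter_bin he n) ih

lemma classify {d : ℕ → ℕ} (hd : IsAltLyndon d) (h0 : d 0 = 1) :
    Pos d ∨ d = phiInf ∨ ∃ n, d = periodicSeq (uW n) := by
  have key : ∀ n, Pos d ∨ (∃ n, d = periodicSeq (uW n)) ∨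
      ∃ e, IsAltLyndon e ∧ e 0 = 1 ∧ d = Phi^[n] e := by
    intro n
    induction n with
    | zero => exact Or.inr (Or.inr ⟨d, hd, h0, rfl⟩)
    | succ n ih =>
      rcases ih with h | h | ⟨e, he, he0, hde⟩
      · exact Or.inl h
      · exact Or.inr (Or.inl h)
      · rcases renorm he he0 with h | h | ⟨f, hf, hf0, hfe⟩
        · exact Or.inr (Or.inl ⟨n, by rw [periodic_uW, hde, h]⟩)
        · exact Or.inl (hde ▸ pos_iter he0 (mem_bin he0 (lyndon_mem he)) h n)
        · exact Or.inr (Or.inr ⟨f, hf, hf0, by rw [hde, hfe, Function.iterate_succ_apply]⟩)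
  by_cases hp : Pos d
  · exact Or.inl hp
  by_cases hq : ∃ n, d = periodicSeq (uW n)
  · exact Or.inr (Or.inr hq)
  right; left
  funext i
  rcases key i with h | h | ⟨e, he, he0, hde⟩
  · exact absurd h hp
  · exact absurd h hq
  · rw [hde, app_one he0, iter_Phi_app, phiInf_eq i i (length_uW i)]
    exact app_lt (uW i) _ i (length_uW i)

/-! ### counting -/

def pre (N : ℕ) (x : ℕ → ℕ) : List ℕ := (List.range N).map x

lemma pre_eq_iff (N : ℕ) (x y : ℕ → ℕ) : pre N x = pre N y ↔ Agr N x y := by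
  simp [pre, Agr, List.map_inj_left]

def ext0 (w : List ℕ) : ℕ → ℕ := fun i => w.getD i 0

lemma ext0_pre (N : ℕ) (x : ℕ → ℕ) : Agr N (ext0 (pre N x)) x := by
  intro i hi
  simp [ext0, pre, List.getD_eq_getElem?_getD, List.getElem?_range, hi]

lemma Hword_set (d : ℕ → ℕ) (N : ℕ) :
    {w : List ℕ | w ∈ LyndonLang d ∧ w.length = N} = pre N '' LyndonSystem d := by
  ext w
  constructor
  · rintro ⟨⟨x, hx, k, hk⟩, rfl⟩
    exact ⟨shiftSeq x k, shift_mem hx k, hk.symm⟩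
  · rintro ⟨x, hx, rfl⟩
    refine ⟨⟨x, hx, 0, ?_⟩, by simp [pre]⟩
    simp [pre]

lemma Hword_eq (d : ℕ → ℕ) (N : ℕ) : Hword d N = (pre N '' LyndonSystem d).ncard := by
  rw [Hword, Hword_set]

lemma fin_pre (d : ℕ → ℕ) (N : ℕ) : (pre N '' LyndonSystem d).Finite := by
  have h := (List.finite_length_eq (Fin (d 0 + 1)) N).image (List.map (fun a : Fin (d 0 + 1) => (a : ℕ)))
  refine h.subset ?_
  rintro _ ⟨x, hx, rfl⟩
  refine ⟨(List.range N).map (fun i => ⟨x i, Nat.lt_succ_of_le (hx.1 i)⟩), by simp, ?_⟩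
  simp [pre]

/-- general upper bound -/
lemma Hword_le (d e : ℕ → ℕ) (N N' c : ℕ) (F : ℕ → (ℕ → ℕ) → (ℕ → ℕ))
    (hF : ∀ i y z, Agr N' y z → Agr N (F i y) (F i z))
    (h : ∀ x ∈ LyndonSystem d, ∃ i < c, ∃ y ∈ LyndonSystem e, Agr N x (F i y)) :
    Hword d N ≤ c * Hword e N' := by
  rw [Hword_eq, Hword_eq]
  have hsub : pre N '' LyndonSystem d ⊆
      (fun p : ℕ × List ℕ => pre N (F p.1 (ext0 p.2))) ''
        ((Set.Iio c) ×ˢ (pre N' '' LyndonSystem e)) := by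
    rintro _ ⟨x, hx, rfl⟩
    obtain ⟨i, hi, y, hy, ha⟩ := h x hx
    refine ⟨(i, pre N' y), ⟨hi, ⟨y, hy, rfl⟩⟩, ?_⟩
    rw [pre_eq_iff]
    intro j hj
    rw [ha j hj]
    exact hF i _ _ (ext0_pre N' y) j hj
  have hfin : ((Set.Iio c) ×ˢ (pre N' '' LyndonSystem e)).Finite :=
    (Set.finite_Iio c).prod (fin_pre e N')
  calc _ ≤ _ := Set.ncard_le_ncard hsub (hfin.image _)
    _ ≤ _ := Set.ncard_image_le hfin
    _ = _ := by rw [Set.ncard_prod]; congr 1; simp [Set.ncard_eq_toFinset_card']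

lemma Gz_agr (N i : ℕ) (x y : ℕ → ℕ) (h : Agr N x y) : Agr N (Gz i x) (Gz i y) := by
  intro j hj
  simp only [Gz]
  split_ifs
  · rfl
  · exact h _ (by omega)

lemma Hword_step {e : ℕ → ℕ} (h0 : e 0 = 1) (he : Bin e) (N : ℕ) :
    Hword (Phi e) N ≤ (N + 1) * Hword e N := by
  refine Hword_le _ _ N N (N + 1) (fun i y => Gz i (Phi y))
    (fun i y z h => Gz_agr _ _ _ _ (Phi_agr _ _ _ h)) fun x hx => ?_
  obtain ⟨i, hi, y, hy, ha⟩ := decomp h0 he hx N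
  exact ⟨i, by omega, y, hy, ha⟩

lemma Phi_Gz_agr (M j : ℕ) (x y : ℕ → ℕ) (h : Agr M (Phi x) (Phi y)) :
    Agr M (Phi (Gz j x)) (Phi (Gz j y)) := by
  induction j with
  | zero =>
    have hg : ∀ x : ℕ → ℕ, Gz 0 x = x := fun x => by funext n; simp [Gz]
    rw [hg, hg]; exact h
  | succ j ih =>
    have hs : ∀ x : ℕ → ℕ, shiftSeq (Gz (j + 1) x) 1 = Gz j x := by
      intro x; funext n
      simp only [shiftSeq, Gz]
      by_cases hn : n < j
      · simp [hn, show 1 + n < j + 1 by omega]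
      · simp [hn, show ¬ (1 + n < j + 1) by omega, show 1 + n - (j + 1) = n - j by omega]
    intro n hn
    cases n with
    | zero => simp [Phi_zero]
    | succ n =>
      rw [Phi_z _ (by simp [Gz]), Phi_z _ (by simp [Gz]), hs, hs]
      exact ih n (by omega)

lemma Phi2_z (x : ℕ → ℕ) (h : x 0 = 0) :
    Phi (Phi x) 1 = 0 ∧ Phi (Phi x) 2 = 0 ∧
      ∀ n, Phi (Phi x) (n + 3) = Phi (Phi (shiftSeq x 1)) n := by
  have h0 : Phi x 0 ≠ 0 := by simp [Phi_zero]
  exact ⟨Phi_o1 _ h0, Phi_o2 _ h0, fun n => by rw [Phi_o _ h0, shift_Phi_z x h]⟩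

lemma Phi2_o (x : ℕ → ℕ) (h : x 0 ≠ 0) :
    Phi (Phi x) 1 = 0 ∧ Phi (Phi x) 2 = 0 ∧ Phi (Phi x) 3 = 1 ∧ Phi (Phi x) 4 = 1 ∧
      ∀ n, Phi (Phi x) (n + 5) = Phi (Phi (shiftSeq x 1)) n := by
  have h0 : Phi x 0 ≠ 0 := by simp [Phi_zero]
  have h1 : shiftSeq (Phi x) 1 0 = 0 := Phi_o1 x h
  have h2 : shiftSeq (shiftSeq (Phi x) 1) 1 0 = 0 := Phi_o2 x h
  refine ⟨Phi_o1 _ h0, Phi_o2 _ h0, ?_, ?_, fun n => ?_⟩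
  · rw [Phi_o _ h0 0, Phi_zero]
  · rw [Phi_o _ h0 1, Phi_z _ h1 0, Phi_zero]
  · rw [Phi_o _ h0 (n + 2), Phi_z _ h1, Phi_z _ h2, shift_shift, shift_shift, shift_Phi_o x h]

lemma Phi2_agr (N : ℕ) (x y : ℕ → ℕ) (h : Agr N x y) :
    Agr (3 * N) (Phi (Phi x)) (Phi (Phi y)) := by
  intro n hn
  induction n using Nat.strong_induction_on generalizing x y N with
  | _ n ih =>
    have h0 := h 0 (by omega)
    have hs : Agr (N - 1) (shiftSeq x 1) (shiftSeq y 1) := fun i hi => h (1 + i) (by omega)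
    by_cases hx : x 0 = 0
    · have hy : y 0 = 0 := h0 ▸ hx
      obtain ⟨a1, a2, a3⟩ := Phi2_z x hx
      obtain ⟨b1, b2, b3⟩ := Phi2_z y hy
      match n with
      | 0 => simp [Phi_zero]
      | 1 => rw [a1, b1]
      | 2 => rw [a2, b2]
      | n + 3 => rw [a3, b3]; exact ih n (by omega) (N - 1) _ _ hs (by omega)
    · have hy : y 0 ≠ 0 := h0 ▸ hx
      obtain ⟨a1, a2, a3, a4, a5⟩ := Phi2_o x hx
      obtain ⟨b1, b2, b3, b4, b5⟩ := Phi2_o y hy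
      match n with
      | 0 => simp [Phi_zero]
      | 1 => rw [a1, b1]
      | 2 => rw [a2, b2]
      | 3 => rw [a3, b3]
      | 4 => rw [a4, b4]
      | n + 5 => rw [a5, b5]; exact ih n (by omega) (N - 1) _ _ hs (by omega)

lemma Hword_phiInf (N : ℕ) :
    Hword phiInf (3 * N) ≤ ((3 * N + 1) * (3 * N + 1)) * Hword phiInf N := by
  set c := 3 * N + 1 with hc
  refine Hword_le _ _ (3 * N) N (c * c)
    (fun i y => Gz (i / c) (Phi (Gz (i % c) (Phi y)))) (fun i y z h => ?_) fun x hx => ?_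
  · exact Gz_agr _ _ _ _ (Phi_Gz_agr _ _ _ _ (Phi2_agr _ _ _ h))
  · rw [← Phi_phiInf] at hx
    obtain ⟨i, hi, y, hy, ha⟩ := decomp phiInf_zero phiInf_bin hx (3 * N)
    rw [← Phi_phiInf] at hy
    obtain ⟨j, hj, z, hz, hb⟩ := decomp phiInf_zero phiInf_bin hy (3 * N)
    refine ⟨c * i + j, ?_, z, hz, ?_⟩
    · nlinarith
    · have e1 : (c * i + j) / c = i := by
        rw [Nat.mul_add_div (by omega), Nat.div_eq_of_lt (by omega), add_zero]
      have e2 : (c * i + j) % c = j := by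
        rw [Nat.mul_add_mod, Nat.mod_eq_of_lt (by omega)]
      intro n hn
      simp only [e1, e2]
      rw [ha n hn]
      exact Gz_agr _ _ _ _ (Phi_agr _ _ _ hb) n hn

lemma one_mem_structure {x : ℕ → ℕ} (hx : x ∈ LyndonSystem (fun _ => 1)) (h0 : x 0 = 1) :
    x = fun _ => 1 := by
  have hb := mem_bin rfl hx
  funext n
  induction n with
  | zero => exact h0
  | succ n ih =>
    by_contra hc
    have := hb (n + 1)
    refine not_le_of_altLt ⟨1, ?_, ?_⟩ (hx.2 n)
    · intro i hi
      obtain rfl : i = 0 := by omega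
      simp [shiftSeq, ih]
    · rw [if_neg (by decide)]; simp [shiftSeq]; omega

lemma Hword_of_zero (N : ℕ) : Hword (fun _ => 0) N ≤ 1 := by
  rw [Hword_eq]
  refine (Set.ncard_le_ncard (t := {pre N (fun _ => 0)}) ?_ (Set.finite_singleton _)).trans
    (by simp)
  rintro _ ⟨x, hx, rfl⟩
  have : x = fun _ => 0 := funext fun i => Nat.le_zero.1 (hx.1 i)
  simp [this]

lemma Hword_of_one (N : ℕ) : Hword (fun _ => 1) N ≤ N + 1 := by
  have := Hword_le (fun _ => 1) (fun _ => 0) N 0 (N + 1) (fun i _ => Gz i (fun _ => 1))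
    (fun i y z _ n _ => rfl) ?_
  · exact this.trans (by have := Hword_of_zero 0; nlinarith)
  · intro x hx
    have hz : (fun _ => 0) ∈ LyndonSystem (fun _ => 0) := ⟨fun _ => le_rfl, fun _ => Or.inl rfl⟩
    rcases first_one x (mem_bin rfl hx) N with h | ⟨i, hi, h1, hG⟩
    · exact ⟨N, by omega, _, hz, fun i hi => by rw [h i hi]; simp [Gz, hi]⟩
    · refine ⟨i, by omega, _, hz, fun n _ => ?_⟩
      have := one_mem_structure (shift_mem hx i) (by simpa [shiftSeq] using h1)
      rw [← this, ← hG]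

lemma Hword_iter (n N : ℕ) : Hword (Phi^[n] (fun _ => 1)) N ≤ (N + 1) ^ (n + 1) := by
  induction n with
  | zero => simpa using Hword_of_one N
  | succ n ih =>
    rw [Function.iterate_succ_apply']
    refine (Hword_step (iter_one n) (iter_bin (fun _ => le_rfl) n) N).trans ?_
    rw [pow_succ' _ (n + 1)]
    exact Nat.mul_le_mul_left _ ih

lemma Phi_inj_agr (m : ℕ) (x y : ℕ → ℕ) (hx : Bin x) (hy : Bin y)
    (h : Agr (3 * m) (Phi x) (Phi y)) : Agr m x y := by
  induction m generalizing x y with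
  | zero => intro i hi; omega
  | succ m ih =>
    have hone := h 1 (by omega)
    have b1 := hx 0
    have b2 := hy 0
    have main : x 0 = y 0 ∧ Agr m (shiftSeq x 1) (shiftSeq y 1) := by
      by_cases hx0 : x 0 = 0
      · by_cases hy0 : y 0 = 0
        · refine ⟨by omega, ih _ _ (hx.shift 1) (hy.shift 1) fun i hi => ?_⟩
          rw [← Phi_z x hx0, ← Phi_z y hy0]
          exact h _ (by omega)
        · rw [Phi_z x hx0 0, Phi_zero, Phi_o1 y hy0] at hone; omega
      · by_cases hy0 : y 0 = 0
        · rw [Phi_z y hy0 0, Phi_zero, Phi_o1 x hx0] at hone; omega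
        · refine ⟨by omega, ih _ _ (hx.shift 1) (hy.shift 1) fun i hi => ?_⟩
          rw [← Phi_o x hx0, ← Phi_o y hy0]
          exact h _ (by omega)
    intro i hi
    cases i with
    | zero => exact main.1
    | succ i => simpa [shiftSeq, add_comm] using main.2 i (by omega)

lemma iter_inj_agr (n m : ℕ) (x y : ℕ → ℕ) (hx : Bin x) (hy : Bin y)
    (h : Agr (3 ^ n * m) (Phi^[n] x) (Phi^[n] y)) : Agr m x y := by
  induction n with
  | zero => simpa using h
  | succ n ih =>
    apply ih
    apply Phi_inj_agr _ _ _ (iter_bin hx n) (iter_bin hy n)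
    rw [← Function.iterate_succ_apply' Phi, ← Function.iterate_succ_apply' Phi, ← mul_assoc, ← pow_succ']
    exact h

def ofB (m : ℕ) (f : Fin m → Bool) : ℕ → ℕ :=
  fun i => if h : i < m then (if f ⟨i, h⟩ then 1 else 0) else 0

lemma ofB_bin (m : ℕ) (f : Fin m → Bool) : Bin (ofB m f) := by
  intro i; unfold ofB; split_ifs <;> simp

lemma Hword_lower {d : ℕ → ℕ} (n : ℕ) (h : ∀ y, Bin y → Phi^[n] y ∈ LyndonSystem d) (m : ℕ) :
    2 ^ m ≤ Hword d (3 ^ n * m) := by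
  rw [Hword_eq]
  let g : (Fin m → Bool) → List ℕ := fun f => pre (3 ^ n * m) (Phi^[n] (ofB m f))
  have hg : Function.Injective g := by
    intro f f' hff
    have := iter_inj_agr n m _ _ (ofB_bin m f) (ofB_bin m f') ((pre_eq_iff _ _ _).1 hff)
    funext i
    have hi := this i i.2
    simp only [ofB, i.2, dif_pos, Fin.eta] at hi
    cases h1 : f i <;> cases h2 : f' i <;> simp [h1, h2] at hi ⊢
  have hc : (Set.range g).ncard = 2 ^ m := by
    rw [← Set.image_univ, Set.ncard_image_of_injective _ hg, Set.ncard_univ]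
    simp
  rw [← hc]
  apply Set.ncard_le_ncard _ (fin_pre _ _)
  rintro _ ⟨f, rfl⟩
  exact ⟨_, h _ (ofB_bin m f), rfl⟩

/-! ### limits -/

lemma E_nonneg {d : ℕ → ℕ} {E : ℝ} (hE : EntropyIs d E) : 0 ≤ E :=
  ge_of_tendsto' hE fun n => div_nonneg (Real.log_natCast_nonneg _) (Nat.cast_nonneg _)

lemma E_pos {d : ℕ → ℕ} {E : ℝ} (hE : EntropyIs d E) (h : Pos d) : 0 < E := by
  obtain ⟨n, hn⟩ := h
  have ht : Tendsto (fun m : ℕ => 3 ^ n * m) atTop atTop :=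
    tendsto_id.const_mul_atTop' (by positivity)
  have h1 := hE.comp ht
  refine lt_of_lt_of_le (b := Real.log 2 / 3 ^ n) (by positivity) (ge_of_tendsto h1 ?_)
  filter_upwards [eventually_gt_atTop 0] with m hm
  simp only [Function.comp]
  have h2 : (2 : ℝ) ^ m ≤ (Hword d (3 ^ n * m) : ℝ) := by exact_mod_cast Hword_lower n hn m
  have h3 := Real.log_le_log (by positivity) h2
  rw [Real.log_pow] at h3
  have hm' : (0 : ℝ) < m := by exact_mod_cast hm
  push_cast
  rw [div_le_div_iff₀ (by positivity) (by positivity)]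
  nlinarith [show (0 : ℝ) < 3 ^ n by positivity]

lemma log_lim : Tendsto (fun n : ℕ => Real.log ((n : ℝ) + 1) / n) atTop (𝓝 0) := by
  have h1 : Tendsto (fun x : ℝ => Real.log x / x) atTop (𝓝 0) := by
    simpa using Real.isLittleO_log_id_atTop.tendsto_div_nhds_zero
  have h2 : Tendsto (fun n : ℕ => (n : ℝ) + 1) atTop atTop :=
    tendsto_atTop_add_const_right _ _ tendsto_natCast_atTop_atTop
  have h3 := (h1.comp h2).const_mul 2
  rw [mul_zero] at h3
  refine squeeze_zero' (Eventually.of_forall fun n => ?_) ?_ h3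
  · exact div_nonneg (Real.log_nonneg (by linarith [Nat.cast_nonneg (α := ℝ) n])) (Nat.cast_nonneg _)
  · filter_upwards [eventually_gt_atTop 0] with n hn
    have hn' : (1 : ℝ) ≤ n := by exact_mod_cast hn
    have hl : 0 ≤ Real.log ((n : ℝ) + 1) := Real.log_nonneg (by linarith)
    simp only [Function.comp]
    rw [← mul_div_assoc, div_le_div_iff₀ (by linarith) (by linarith)]
    nlinarith

lemma E_zero_of_poly {d : ℕ → ℕ} {E : ℝ} (hE : EntropyIs d E) (k : ℕ)
    (h : ∀ N, Hword d N ≤ (N + 1) ^ k) : E = 0 := by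
  refine le_antisymm ?_ (E_nonneg hE)
  have h1 := log_lim.const_mul (k : ℝ)
  rw [mul_zero] at h1
  refine le_of_tendsto_of_tendsto' hE h1 fun n => ?_
  rw [← mul_div_assoc]
  gcongr
  rw [← Real.log_pow]
  rcases Nat.eq_zero_or_pos (Hword d n) with h0 | h0
  · rw [h0]
    simp only [Nat.cast_zero, Real.log_zero]
    exact Real.log_nonneg (one_le_pow₀ (by linarith [Nat.cast_nonneg (α := ℝ) n]))
  · apply Real.log_le_log (by exact_mod_cast h0)
    exact_mod_cast h n

lemma Hword_phiInf_pos (N : ℕ) : 0 < Hword phiInf N := by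
  rw [Hword_eq]
  exact (Set.ncard_pos (fin_pre _ _)).2 ⟨_, _, zero_mem phiInf_zero, rfl⟩

lemma E_zero_phiInf {E : ℝ} (hE : EntropyIs phiInf E) : E = 0 := by
  refine le_antisymm ?_ (E_nonneg hE)
  have ht : Tendsto (fun m : ℕ => 3 * m) atTop atTop :=
    tendsto_id.const_mul_atTop' (by norm_num)
  have h1 := hE.comp ht
  have h2 := ((log_lim.comp ht).const_mul 2).add (hE.div_const 3)
  have h3 : E ≤ 2 * 0 + E / 3 := by
    refine le_of_tendsto_of_tendsto h1 h2 ?_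
    filter_upwards [eventually_gt_atTop 0] with m hm
    have hm' : (0 : ℝ) < m := by exact_mod_cast hm
    simp only [Function.comp]
    have hp : (0 : ℝ) < Hword phiInf m := by exact_mod_cast Hword_phiInf_pos m
    have hq : (0 : ℝ) < Hword phiInf (3 * m) := by exact_mod_cast Hword_phiInf_pos (3 * m)
    have hle : (Hword phiInf (3 * m) : ℝ) ≤
        (((3 * m : ℕ) + 1 : ℝ) * ((3 * m : ℕ) + 1)) * Hword phiInf m := by
      exact_mod_cast Hword_phiInf m
    have hl := Real.log_le_log hq hle
    rw [Real.log_mul (by positivity) (by positivity), Real.log_mul (by positivity) (by positivity)] at hl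
    push_cast at hl ⊢
    have e : 2 * (Real.log (3 * (m : ℝ) + 1) / (3 * m)) + Real.log (Hword phiInf m) / m / 3
        = (Real.log (3 * (m : ℝ) + 1) + Real.log (3 * (m : ℝ) + 1) +
          Real.log (Hword phiInf m)) / (3 * m) := by
      field_simp; ring
    rw [e]
    gcongr
  linarith

/-- Theorem 1 (b): `M` has zero entropy iff `(d_i)` is `\overline{0}`, or `φ^∞(1)`,
or `\overline{φ^n(1)}` for some `n`. -/
theorem stmt11 (d : ℕ → ℕ) (E : ℝ) (hd : IsAltLyndon d) (hE : EntropyIs d E) :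
    E = 0 ↔ d = (fun _ => 0) ∨ d = phiInf ∨ ∃ n : ℕ, d = periodicSeq (uW n) := by

  constructor
  · intro h0
    rcases Nat.lt_trichotomy (d 0) 1 with h | h | h
    · left
      funext i
      have := (lyndon_mem hd).1 i
      omega
    · rcases classify hd h with hp | hp
      · exact absurd h0 (E_pos hE hp).ne'
      · exact Or.inr hp
    · exact absurd h0 (E_pos hE (pos_of_two_le h)).ne'
  · rintro (rfl | rfl | ⟨n, rfl⟩)
    · exact E_zero_of_poly hE 0 (by simpa using Hword_of_zero)
    · exact E_zero_phiInf hE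
    · rw [periodic_uW] at hE
      exact E_zero_of_poly hE (n + 1) (Hword_iter n)
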